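/- Assume f₁ = f₂, and write F̲(w) = f₁(‖w₁‖²,‖w₂‖²) for w = (w₁,w₂) ∈ 𝓗². Let R > 0 and let u₀ ∈ 𝓗² satisfy Θ_R u₀ = u₀ and ‖u₁(0)‖² + ‖u₂(0)‖² = 1. Let u be the solution of the nonlinear Landau–Zener system with datum u₀ and let u^lin be the solution of the linear system (δ = 0) with the same datum u₀. Let (α,ω) be the incoming/outgoing scattering states of u, i.e. the unique elements of 𝓗² with ‖u₁(s) − e^{iδF₁(ω)s}·e^{iφ(s,GG*)}ω₁‖ + ‖u₂(s) − e^{iδF₂(ω)s}·e^{−iφ(s,G*G)}ω₂‖ → 0 as s → +∞ and ‖u₁(s) − e^{iδF₁(α)s}·e^{iφ(s,GG*)}α₁‖ + ‖u₂(s) − e^{iδF₂(α)s}·e^{−iφ(s,G*G)}α₂‖ → 0 as s → −∞, and let (α^lin,ω^lin) be the analogous scattering states of u^lin (with δ = 0). Then the improper integrals Λ⁻ = ∫_{−∞}^0 (F̲(u^lin(τ)) − F̲(α^lin)) dτ and Λ⁺ = ∫_0^{+∞} (F̲(u^lin(τ)) − F̲(ω^lin)) dτ converge, and ω = e^{iδΛ⁺}·ω^lin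 and α = e^{−iδΛ⁻}·α^lin. -/

import Mathlib

open ContinuousLinearMap Complex Filter Topology
open scoped InnerProductSpace

noncomputable section

variable {H : Type*} [NormedAddCommGroup H] [InnerProductSpace ℂ H] [CompleteSpace H]

/-- Functional calculus `χ(A)` of a selfadjoint operator `A` for a complex-valued
function `χ : ℝ → ℂ` (defined via the real continuous functional calculus applied to
the real and imaginary parts of `χ`). -/
def fc (χ : ℝ → ℂ) (A : H →L[ℂ] H) : H →L[ℂ] H :=
  cfc (fun x : ℝ => (χ x).re) A + Complex.I • cfc (fun x : ℝ => (χ x).im) A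

/-- The commutation assumption: for every continuous `χ : ℝ → ℂ`,
`χ(GG*)G = Gχ(G*G)` and `χ(G*G)G* = G*χ(GG*)`. -/
def CommHyp (G : H →L[ℂ] H) : Prop :=
  ∀ χ : ℝ → ℂ, Continuous χ →
    (fc χ (G * ContinuousLinearMap.adjoint G)) ∘L G
        = G ∘L (fc χ (ContinuousLinearMap.adjoint G * G)) ∧
    (fc χ (ContinuousLinearMap.adjoint G * G)) ∘L ContinuousLinearMap.adjoint G
        = ContinuousLinearMap.adjoint G ∘L (fc χ (G * ContinuousLinearMap.adjoint G))

/-- The equivalence between `𝓗²` (with its Hilbert space structure) and `𝓗 × 𝓗`. -/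
def eqv : WithLp 2 (H × H) ≃L[ℂ] H × H := WithLp.prodContinuousLinearEquiv 2 ℂ H H

/-- The operator `V(s)(w₁,w₂) = (s·w₁ + Gw₂, G*w₁ − s·w₂)` on `𝓗²`. -/
def Vop (G : H →L[ℂ] H) (s : ℝ) : WithLp 2 (H × H) →L[ℂ] WithLp 2 (H × H) :=
  (eqv (H := H)).symm.toContinuousLinearMap ∘L
    ((((s : ℂ) • ContinuousLinearMap.fst ℂ H H + G ∘L ContinuousLinearMap.snd ℂ H H)).prod
      ((ContinuousLinearMap.adjoint G) ∘L ContinuousLinearMap.fst ℂ H H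
        - (s : ℂ) • ContinuousLinearMap.snd ℂ H H)) ∘L
    (eqv (H := H)).toContinuousLinearMap

/-- `F₁(u) = f₁(‖u₁‖², ‖u₂‖²)`. -/
def F1 (f₁ : ℝ × ℝ → ℝ) (u : WithLp 2 (H × H)) : ℝ := f₁ (‖u.fst‖ ^ 2, ‖u.snd‖ ^ 2)

/-- `F₂(u) = f₂(‖u₁‖², ‖u₂‖²)`. -/
def F2 (f₂ : ℝ × ℝ → ℝ) (u : WithLp 2 (H × H)) : ℝ := f₂ (‖u.fst‖ ^ 2, ‖u.snd‖ ^ 2)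

/-- The nonlinear term `F(u)u = (F₁(u)u₁, F₂(u)u₂)`. -/
def nlt (f₁ f₂ : ℝ × ℝ → ℝ) (u : WithLp 2 (H × H)) : WithLp 2 (H × H) :=
  (WithLp.equiv 2 (H × H)).symm ((F1 f₁ u) • u.fst, (F2 f₂ u) • u.snd)

/-- `u` is a (global, `C¹`) solution of `−i u′(s) = V(s)u(s) + δ F(u(s))u(s)`:
equivalently, `u′(s) = i (V(s)u(s) + δ F(u(s))u(s))` for all `s`. -/
def IsLZSol (G : H →L[ℂ] H) (δ : ℝ) (f₁ f₂ : ℝ × ℝ → ℝ) (u : ℝ → WithLp 2 (H × H)) : Prop :=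
  ∀ s : ℝ, HasDerivAt u (Complex.I • (Vop G s (u s) + δ • nlt f₁ f₂ (u s))) s

/-- `f ∈ C²(ℝ²;ℝ)` with bounded second derivative. -/
def C2Bdd (f : ℝ × ℝ → ℝ) : Prop :=
  ContDiff ℝ 2 f ∧ ∃ C : ℝ, ∀ p : ℝ × ℝ, ‖iteratedFDeriv ℝ 2 f p‖ ≤ C

/-- `θ ∈ C_c^∞(ℝ;ℝ)`, `0 ≤ θ ≤ 1`, `θ = 1` on `(−1/2,1/2)` and `θ = 0` outside `[−1,1]`. -/
def IsCutoff (θ : ℝ → ℝ) : Prop :=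
  ContDiff ℝ (⊤ : ℕ∞) θ ∧ HasCompactSupport θ ∧ (∀ x, 0 ≤ θ x ∧ θ x ≤ 1) ∧
    (∀ x, |x| < 1/2 → θ x = 1) ∧ (∀ x, 1 < |x| → θ x = 0)

/-- The cutoff operator `Θ_R = diag(θ(GG*/R²), θ(G*G/R²))`. -/
def Theta (G : H →L[ℂ] H) (θ : ℝ → ℝ) (R : ℝ) :
    WithLp 2 (H × H) →L[ℂ] WithLp 2 (H × H) :=
  (eqv (H := H)).symm.toContinuousLinearMap ∘L
    ((cfc (fun x : ℝ => θ (x / R ^ 2)) (G * ContinuousLinearMap.adjoint G)).prodMap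
      (cfc (fun x : ℝ => θ (x / R ^ 2)) (ContinuousLinearMap.adjoint G * G))) ∘L
    (eqv (H := H)).toContinuousLinearMap

/-- The phase `φ(s,λ) = s²/2 + (λ/2)·log|s|`. -/
def phase (s lam : ℝ) : ℝ := s ^ 2 / 2 + lam / 2 * Real.log |s|

/-- The unitary operator `e^{iφ(s,GG*)}` on `𝓗`. -/
def ePhaseP (G : H →L[ℂ] H) (s : ℝ) : H →L[ℂ] H :=
  fc (fun lam => Complex.exp (Complex.I * (phase s lam))) (G * ContinuousLinearMap.adjoint G)

/-- The unitary operator `e^{−iφ(s,G*G)}` on `𝓗`. -/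
def ePhaseM (G : H →L[ℂ] H) (s : ℝ) : H →L[ℂ] H :=
  fc (fun lam => Complex.exp (-(Complex.I * (phase s lam))))
    (ContinuousLinearMap.adjoint G * G)

/-- The model asymptotic first component `e^{iδF₁(ω)s + iϕ}·e^{iφ(s,GG*)}ω₁`. -/
def asym1 (G : H →L[ℂ] H) (δ : ℝ) (f₁ : ℝ × ℝ → ℝ) (ω : WithLp 2 (H × H)) (ϕ : ℝ)
    (s : ℝ) : H :=
  Complex.exp (Complex.I * (δ * F1 f₁ ω * s + ϕ)) • (ePhaseP G s ω.fst)

/-- The model asymptotic second component `e^{iδF₂(ω)s − iϕ}·e^{−iφ(s,G*G)}ω₂`. -/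
def asym2 (G : H →L[ℂ] H) (δ : ℝ) (f₂ : ℝ × ℝ → ℝ) (ω : WithLp 2 (H × H)) (ϕ : ℝ)
    (s : ℝ) : H :=
  Complex.exp (Complex.I * (δ * F2 f₂ ω * s - ϕ)) • (ePhaseM G s ω.snd)

/-- `α` is the incoming scattering state (at `s → −∞`) of `u`, with phase shift `ϕ`. -/
def Incoming (G : H →L[ℂ] H) (δ : ℝ) (f₁ f₂ : ℝ × ℝ → ℝ) (α : WithLp 2 (H × H)) (ϕ : ℝ)
    (u : ℝ → WithLp 2 (H × H)) : Prop :=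
  Tendsto (fun s => ‖(u s).fst - asym1 G δ f₁ α ϕ s‖ + ‖(u s).snd - asym2 G δ f₂ α ϕ s‖)
    atBot (𝓝 0)

/-- `ω` is the outgoing scattering state (at `s → +∞`) of `u`, with phase shift `ϕ`. -/
def Outgoing (G : H →L[ℂ] H) (δ : ℝ) (f₁ f₂ : ℝ × ℝ → ℝ) (ω : WithLp 2 (H × H)) (ϕ : ℝ)
    (u : ℝ → WithLp 2 (H × H)) : Prop :=
  Tendsto (fun s => ‖(u s).fst - asym1 G δ f₁ ω ϕ s‖ + ‖(u s).snd - asym2 G δ f₂ ω ϕ s‖)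
    atTop (𝓝 0)

/-- `M(u) = (δ/2)(F₁(u) + F₂(u))`. -/
def Mscal (δ : ℝ) (f₁ f₂ : ℝ × ℝ → ℝ) (u : WithLp 2 (H × H)) : ℝ :=
  δ / 2 * (F1 f₁ u + F2 f₂ u)

/-- `m(u) = (δ/2)(F₁(u) − F₂(u))`. -/
def mscal (δ : ℝ) (f₁ f₂ : ℝ × ℝ → ℝ) (u : WithLp 2 (H × H)) : ℝ :=
  δ / 2 * (F1 f₁ u - F2 f₂ u)

/-- The gauge transform `v(s) = e^{−i∫₀ˢ M(u(τ))dτ}·u(s)`. -/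
def gaugeT (δ : ℝ) (f₁ f₂ : ℝ × ℝ → ℝ) (u : ℝ → WithLp 2 (H × H)) :
    ℝ → WithLp 2 (H × H) :=
  fun s => Complex.exp (-(Complex.I * (∫ τ in (0:ℝ)..s, Mscal δ f₁ f₂ (u τ)))) • u s

/-- `σ(s) = s + m(u(s))`. -/
def sigma (δ : ℝ) (f₁ f₂ : ℝ × ℝ → ℝ) (u : ℝ → WithLp 2 (H × H)) (s : ℝ) : ℝ :=
  s + mscal δ f₁ f₂ (u s)

/-- The operator `Λ_t = diag((t² + GG*)^{1/2}, (t² + G*G)^{1/2})` on `𝓗²`. -/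
def LamOp (G : H →L[ℂ] H) (t : ℝ) : WithLp 2 (H × H) →L[ℂ] WithLp 2 (H × H) :=
  (eqv (H := H)).symm.toContinuousLinearMap ∘L
    ((cfc (fun x : ℝ => Real.sqrt (t ^ 2 + x)) (G * ContinuousLinearMap.adjoint G)).prodMap
      (cfc (fun x : ℝ => Real.sqrt (t ^ 2 + x)) (ContinuousLinearMap.adjoint G * G))) ∘L
    (eqv (H := H)).toContinuousLinearMap

/-- The operator `Λ_t⁻¹ = diag((t² + GG*)^{-1/2}, (t² + G*G)^{-1/2})` on `𝓗²`. -/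
def LamInv (G : H →L[ℂ] H) (t : ℝ) : WithLp 2 (H × H) →L[ℂ] WithLp 2 (H × H) :=
  (eqv (H := H)).symm.toContinuousLinearMap ∘L
    ((cfc (fun x : ℝ => (Real.sqrt (t ^ 2 + x))⁻¹)
        (G * ContinuousLinearMap.adjoint G)).prodMap
      (cfc (fun x : ℝ => (Real.sqrt (t ^ 2 + x))⁻¹)
        (ContinuousLinearMap.adjoint G * G))) ∘L
    (eqv (H := H)).toContinuousLinearMap

/-- The projection `Π_t^+ = (1/2)(Id + Λ_t⁻¹V(t))`. -/
def PiP (G : H →L[ℂ] H) (t : ℝ) : WithLp 2 (H × H) →L[ℂ] WithLp 2 (H × H) :=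
  (2 : ℂ)⁻¹ • (1 + LamInv G t ∘L Vop G t)

/-- The projection `Π_t^- = (1/2)(Id − Λ_t⁻¹V(t))`. -/
def PiM (G : H →L[ℂ] H) (t : ℝ) : WithLp 2 (H × H) →L[ℂ] WithLp 2 (H × H) :=
  (2 : ℂ)⁻¹ • (1 - LamInv G t ∘L Vop G t)

/-- `m̃(x,y) = (δ/2)(f₁(x,y) − f₂(x,y))`. -/
def mtilde (δ : ℝ) (f₁ f₂ : ℝ × ℝ → ℝ) : ℝ × ℝ → ℝ := fun p => δ / 2 * (f₁ p - f₂ p)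

/-- `m̲(s) = (∂₁m̃ − ∂₂m̃)(‖v₁(s)‖², ‖v₂(s)‖²)`. -/
def mbar (δ : ℝ) (f₁ f₂ : ℝ × ℝ → ℝ) (v : ℝ → WithLp 2 (H × H)) (s : ℝ) : ℝ :=
  fderiv ℝ (mtilde δ f₁ f₂) (‖(v s).fst‖ ^ 2, ‖(v s).snd‖ ^ 2) (1, 0) -
    fderiv ℝ (mtilde δ f₁ f₂) (‖(v s).fst‖ ^ 2, ‖(v s).snd‖ ^ 2) (0, 1)


/-- The operator `A(a,b,c,d)(w₁,w₂) = (a(GG*)w₁ + b(GG*)Gw₂, c(G*G)G*w₁ + d(G*G)w₂)`. -/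
def Aop (G : H →L[ℂ] H) (a b c d : ℝ → ℂ) :
    WithLp 2 (H × H) →L[ℂ] WithLp 2 (H × H) :=
  (eqv (H := H)).symm.toContinuousLinearMap ∘L
    (((fc a (G * ContinuousLinearMap.adjoint G)) ∘L ContinuousLinearMap.fst ℂ H H
        + (fc b (G * ContinuousLinearMap.adjoint G)) ∘L G ∘L ContinuousLinearMap.snd ℂ H H).prod
      ((fc c (ContinuousLinearMap.adjoint G * G)) ∘L (ContinuousLinearMap.adjoint G)
          ∘L ContinuousLinearMap.fst ℂ H H
        + (fc d (ContinuousLinearMap.adjoint G * G)) ∘L ContinuousLinearMap.snd ℂ H H)) ∘L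
    (eqv (H := H)).toContinuousLinearMap

/-- The operator `𝒦(w₁,w₂) = (−Gw₂, G*w₁)` on `𝓗²`. -/
def Kcal (G : H →L[ℂ] H) : WithLp 2 (H × H) →L[ℂ] WithLp 2 (H × H) :=
  (eqv (H := H)).symm.toContinuousLinearMap ∘L
    ((-(G ∘L ContinuousLinearMap.snd ℂ H H)).prod
      ((ContinuousLinearMap.adjoint G) ∘L ContinuousLinearMap.fst ℂ H H)) ∘L
    (eqv (H := H)).toContinuousLinearMap


/-- If `|P'| ≤ -b'` on `[1, ∞)` with `b ≥ 0` and `b → 0`, then `P` converges at rate `b`. -/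
theorem exists_tendsto_of_abs_deriv_le {P P' b b' : ℝ → ℝ}
    (hP : ∀ s, 1 ≤ s → HasDerivAt P (P' s) s) (hb : ∀ s, 1 ≤ s → HasDerivAt b (b' s) s)
    (hPb : ∀ s, 1 ≤ s → |P' s| ≤ -b' s) (hb0 : ∀ s, 1 ≤ s → 0 ≤ b s)
    (hblim : Tendsto b atTop (𝓝 0)) :
    ∃ L, Tendsto P atTop (𝓝 L) ∧ ∀ s, 1 ≤ s → |P s - L| ≤ b s := by
  have h1 : AntitoneOn (fun s => P s + b s) (Set.Ici 1) := by
    refine antitoneOn_of_hasDerivWithinAt_nonpos (f' := fun s => P' s + b' s) (convex_Ici 1)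
      (fun s hs => ((hP s hs).add (hb s hs)).continuousAt.continuousWithinAt)
      (fun s hs => ?_) (fun s hs => ?_)
    · rw [interior_Ici] at hs
      exact ((hP s hs.le).add (hb s hs.le)).hasDerivWithinAt
    · rw [interior_Ici] at hs
      linarith [le_abs_self (P' s), hPb s hs.le]
  have h2 : MonotoneOn (fun s => P s - b s) (Set.Ici 1) := by
    refine monotoneOn_of_hasDerivWithinAt_nonneg (f' := fun s => P' s - b' s) (convex_Ici 1)
      (fun s hs => ((hP s hs).sub (hb s hs)).continuousAt.continuousWithinAt)
      (fun s hs => ?_) (fun s hs => ?_)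
    · rw [interior_Ici] at hs
      exact ((hP s hs.le).sub (hb s hs.le)).hasDerivWithinAt
    · rw [interior_Ici] at hs
      linarith [neg_abs_le (P' s), hPb s hs.le]
  have h3 : ∀ s t, 1 ≤ s → s ≤ t → |P t - P s| ≤ b s := by
    intro s t hs hst
    have e1 := h1 (Set.mem_Ici.2 hs) (Set.mem_Ici.2 (hs.trans hst)) hst
    have e2 := h2 (Set.mem_Ici.2 hs) (Set.mem_Ici.2 (hs.trans hst)) hst
    have e3 := hb0 t (hs.trans hst)
    simp only at e1 e2
    rw [abs_le]
    constructor <;> linarith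
  have hc : CauchySeq P := by
    rw [Metric.cauchySeq_iff']
    intro ε hε
    obtain ⟨N, hN1, hN⟩ :=
      ((eventually_ge_atTop (1 : ℝ)).and (hblim.eventually (gt_mem_nhds hε))).exists
    refine ⟨N, fun n hn => ?_⟩
    rw [Real.dist_eq]
    exact (h3 N n hN1 hn).trans_lt hN
  obtain ⟨L, hL⟩ := cauchySeq_tendsto_of_complete hc
  refine ⟨L, hL, fun s hs => ?_⟩
  rw [abs_sub_comm]
  exact le_of_tendsto (hL.sub_const (P s)).abs
    ((eventually_ge_atTop s).mono fun t ht => h3 s t hs ht)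

/-- Second-order behaviour at infinity of the Bloch-type system `x' = -2q`, `p' = 2sq`,
`q' = -2sp + D` with bounded `p`, `q`, `D`. -/
theorem exists_bound_of_bloch_system {x p q D : ℝ → ℝ} {C X : ℝ}
    (hx : ∀ s, HasDerivAt x (-2 * q s) s) (hp : ∀ s, HasDerivAt p (2 * s * q s) s)
    (hq : ∀ s, HasDerivAt q (-2 * s * p s + D s) s)
    (hpC : ∀ s, |p s| ≤ C) (hqC : ∀ s, |q s| ≤ C) (hDC : ∀ s, |D s| ≤ C)
    (hX : Tendsto x atTop (𝓝 X)) :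
    ∀ s, 1 ≤ s → |x s - X| ≤ 10 * C / s ∧
      |x s - X - ((-2 * s * p s + D s) / (2 * s ^ 2) - q s / s ^ 3)| ≤ 10 * C / s ^ 2 := by
  have hC : 0 ≤ C := (abs_nonneg _).trans (hpC 0)
  have hinv : ∀ n : ℕ, n ≠ 0 → Tendsto (fun s : ℝ => C / s ^ n) atTop (𝓝 0) := fun n hn =>
    tendsto_const_nhds.div_atTop (tendsto_pow_atTop hn)
  obtain ⟨L, hL, hLb⟩ := exists_tendsto_of_abs_deriv_le
    (P := fun s => x s + p s / s - q s / (2 * s ^ 3))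
    (P' := fun s => -D s / (2 * s ^ 3) + 3 * q s / (2 * s ^ 4))
    (b := fun s => C / s ^ 2) (b' := fun s => -(2 * C / s ^ 3))
    (fun s hs => by
      have hs0 : s ≠ 0 := by positivity
      have := ((hx s).add ((hp s).div (hasDerivAt_id s) hs0)).sub
        ((hq s).div (((hasDerivAt_id s).pow 3).const_mul 2) (by simp [hs0]))
      refine this.congr_deriv ?_
      simp
      field_simp
      ring)
    (fun s hs => by
      have hs0 : s ≠ 0 := by positivity
      have := (hasDerivAt_const s C).div ((hasDerivAt_id s).pow 2) (by simp [hs0])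
      refine this.congr_deriv ?_
      simp
      field_simp)
    (fun s hs => by
      have hs0 : 0 < s := by positivity
      have h1 : |-D s / (2 * s ^ 3)| ≤ C / (2 * s ^ 3) := by
        rw [abs_div, abs_neg, abs_of_pos (by positivity : 0 < 2 * s ^ 3)]
        gcongr
        exact hDC s
      have h2 : |3 * q s / (2 * s ^ 4)| ≤ 3 * C / (2 * s ^ 3) := by
        rw [abs_div, abs_mul, abs_of_pos (by positivity : 0 < 2 * s ^ 4),
          abs_of_pos (by norm_num : (0 : ℝ) < 3)]
        gcongr
        · exact hqC s
        · norm_num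
      calc _ ≤ _ := abs_add_le _ _
        _ ≤ _ := add_le_add h1 h2
        _ = _ := by ring)
    (fun s hs => by positivity) (hinv 2 (by norm_num))
  have hLX : L = X := by
    refine tendsto_nhds_unique hL ?_
    have h1 : Tendsto (fun s => p s / s) atTop (𝓝 0) := by
      refine squeeze_zero_norm' ?_ (hinv 1 one_ne_zero)
      filter_upwards [eventually_ge_atTop 1] with s hs
      rw [Real.norm_eq_abs, abs_div, abs_of_pos (by positivity : 0 < s), pow_one]
      gcongr
      exact hpC s
    have h2 : Tendsto (fun s => q s / (2 * s ^ 3)) atTop (𝓝 0) := by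
      refine squeeze_zero_norm' ?_ (hinv 3 (by norm_num))
      filter_upwards [eventually_ge_atTop 1] with s hs
      rw [Real.norm_eq_abs, abs_div, abs_of_pos (by positivity : 0 < 2 * s ^ 3)]
      gcongr
      · exact hqC s
      · nlinarith [pow_pos (by positivity : 0 < s) 3]
    simpa using (hX.add h1).sub h2
  subst hLX
  intro s hs
  have hs0 : 0 < s := by positivity
  have hsub : ∀ {z : ℝ} {n m : ℕ}, |z| ≤ C → m ≤ n → |z / s ^ n| ≤ C / s ^ m := by
    intro z n m hz hnm
    rw [abs_div, abs_of_pos (by positivity : 0 < s ^ n)]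
    gcongr
  constructor
  · have e : x s - L = (x s + p s / s - q s / (2 * s ^ 3) - L) - p s / s ^ 1
        + 1 / 2 * (q s / s ^ 3) := by ring
    have h0 := abs_le.1 ((hLb s hs).trans (by gcongr; exacts [one_le_two] : C / s ^ 2 ≤ C / s ^ 1))
    have h1 := abs_le.1 (hsub (n := 1) (m := 1) (hpC s) le_rfl)
    have h2 := abs_le.1 (hsub (n := 3) (m := 1) (hqC s) (by norm_num))
    have h3 : 10 * C / s = 10 * (C / s ^ 1) := by ring
    have h4 : 0 ≤ C / s ^ 1 := by positivity
    rw [e, h3, abs_le]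
    constructor <;> linarith
  · have e : x s - L - ((-2 * s * p s + D s) / (2 * s ^ 2) - q s / s ^ 3)
        = (x s + p s / s - q s / (2 * s ^ 3) - L) - 1 / 2 * (D s / s ^ 2)
        + 3 / 2 * (q s / s ^ 3) := by
      field_simp
      ring
    have h0 := abs_le.1 (hLb s hs)
    have h1 := abs_le.1 (hsub (n := 2) (m := 2) (hDC s) le_rfl)
    have h2 := abs_le.1 (hsub (n := 3) (m := 2) (hqC s) (by norm_num))
    have h3 : 10 * C / s ^ 2 = 10 * (C / s ^ 2) := by ring
    have h4 : 0 ≤ C / s ^ 2 := by positivity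
    rw [e, h3, abs_le]
    constructor <;> linarith

/-- Quadratic bound for the first-order Taylor remainder of a `C²` function on a line. -/
theorem exists_taylor_bound {g : ℝ → ℝ} (hg : ContDiff ℝ 2 g) :
    ∃ L r, 0 ≤ L ∧ 0 < r ∧ ∀ e, |e| < r → |g e - g 0 - deriv g 0 * e| ≤ L * e ^ 2 := by
  have hd : ContDiff ℝ 1 (deriv g) := hg.deriv'
  obtain ⟨L, t, ht, hL⟩ := (hd.contDiffAt (x := 0)).exists_lipschitzOnWith
  obtain ⟨r, hr, hrt⟩ := Metric.mem_nhds_iff.1 ht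
  refine ⟨L, r, L.2, hr, fun e he => ?_⟩
  have hder : ∀ y, HasDerivAt (fun y => g y - deriv g 0 * y) (deriv g y - deriv g 0) y := by
    intro y
    have := ((hg.differentiable (by norm_num)) y).hasDerivAt.sub
      ((hasDerivAt_id y).const_mul (deriv g 0))
    exact this.congr_deriv (by simp)
  have := (convex_closedBall (0 : ℝ) |e|).norm_image_sub_le_of_norm_hasDerivWithin_le
    (C := L * |e|) (fun y _ => (hder y).hasDerivWithinAt) (fun y hy => ?_)
    (x := 0) (y := e) (by simp) (by simp)
  · simp only [Real.norm_eq_abs, mul_zero, sub_zero] at this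
    calc |g e - g 0 - deriv g 0 * e| = |g e - deriv g 0 * e - g 0| := by ring_nf
      _ ≤ L * |e| * |e| := this
      _ = L * e ^ 2 := by rw [mul_assoc, abs_mul_abs_self, sq]
  · have hy' : |y| ≤ |e| := by simpa using hy
    have h1 := hL.dist_le_mul y (hrt (by simpa using hy'.trans_lt he)) 0
      (hrt (by simpa using hr))
    rw [dist_eq_norm, dist_eq_norm, sub_zero, Real.norm_eq_abs y] at h1
    exact h1.trans (by gcongr)

/-- Convergence of the improper integral of `g (x - X) - g 0` along a Bloch-type system. -/
theorem exists_tendsto_integral_of_bloch_system {x p q D g : ℝ → ℝ} {C X : ℝ}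
    (hx : ∀ s, HasDerivAt x (-2 * q s) s) (hp : ∀ s, HasDerivAt p (2 * s * q s) s)
    (hq : ∀ s, HasDerivAt q (-2 * s * p s + D s) s)
    (hpC : ∀ s, |p s| ≤ C) (hqC : ∀ s, |q s| ≤ C) (hDC : ∀ s, |D s| ≤ C)
    (hX : Tendsto x atTop (𝓝 X)) (hg : ContDiff ℝ 2 g) :
    ∃ Λ, Tendsto (fun t : ℝ => ∫ τ in (0 : ℝ)..t, (g (x τ - X) - g 0)) atTop (𝓝 Λ) := by
  have hC : 0 ≤ C := (abs_nonneg _).trans (hpC 0)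
  have hb := exists_bound_of_bloch_system hx hp hq hpC hqC hDC hX
  obtain ⟨L, r, hL, hr, hT⟩ := exists_taylor_bound hg
  have hxc : Continuous x := continuous_iff_continuousAt.2 fun s => (hx s).continuousAt
  have hW : Continuous fun τ => g (x τ - X) - g 0 :=
    (hg.continuous.comp (hxc.sub continuous_const)).sub continuous_const
  have hk : Tendsto (fun s => q s / (2 * s ^ 2)) atTop (𝓝 0) := by
    refine squeeze_zero_norm' ?_
      (tendsto_const_nhds.div_atTop (tendsto_pow_atTop two_ne_zero) :
        Tendsto (fun s : ℝ => C / s ^ 2) atTop (𝓝 0))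
    filter_upwards [eventually_ge_atTop 1] with s hs
    rw [Real.norm_eq_abs, abs_div, abs_of_pos (by positivity : 0 < 2 * s ^ 2)]
    gcongr
    · exact hqC s
    · nlinarith
  obtain ⟨S, hS⟩ := eventually_atTop.1 ((hX.sub_const X).abs.eventually
    (gt_mem_nhds (by simpa using hr)))
  set T := max S 1
  set B := L * (10 * C) ^ 2 + |deriv g 0| * (10 * C) with hB
  have hB0 : 0 ≤ B := by positivity
  have hPd : ∀ s, 1 ≤ s → HasDerivAt
      (fun s => (∫ τ in (0 : ℝ)..s, (g (x τ - X) - g 0)) - deriv g 0 * (q s / (2 * s ^ 2)))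
      (g (x s - X) - g 0
        - deriv g 0 * ((-2 * s * p s + D s) / (2 * s ^ 2) - q s / s ^ 3)) s := by
    intro s hs
    have hs0 : s ≠ 0 := by positivity
    refine (hW.integral_hasStrictDerivAt 0 s).hasDerivAt.sub (HasDerivAt.const_mul _ ?_)
    refine ((hq s).div (((hasDerivAt_id s).pow 2).const_mul 2) (by simp [hs0])).congr_deriv ?_
    simp
    field_simp
  have hPb : ∀ s, T ≤ s → |g (x s - X) - g 0
        - deriv g 0 * ((-2 * s * p s + D s) / (2 * s ^ 2) - q s / s ^ 3)| ≤ B / s ^ 2 := by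
    intro s hs
    have hs1 : 1 ≤ s := (le_max_right _ _).trans hs
    have hs0 : 0 < s := by positivity
    have h1 := hT (x s - X) (hS s ((le_max_left _ _).trans hs))
    obtain ⟨h2, h3⟩ := hb s hs1
    have h4 : (x s - X) ^ 2 ≤ (10 * C / s) ^ 2 := sq_le_sq' (abs_le.1 h2).1 (abs_le.1 h2).2
    calc _ = |(g (x s - X) - g 0 - deriv g 0 * (x s - X)) + deriv g 0 *
          (x s - X - ((-2 * s * p s + D s) / (2 * s ^ 2) - q s / s ^ 3))| := by ring_nf
      _ ≤ L * (10 * C / s) ^ 2 + |deriv g 0| * (10 * C / s ^ 2) := by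
        refine (abs_add_le _ _).trans (add_le_add (h1.trans (by gcongr)) ?_)
        rw [abs_mul]
        gcongr
      _ = B / s ^ 2 := by rw [hB]; ring
  have hT1 : 1 ≤ T := le_max_right _ _
  obtain ⟨Λ, hΛ, -⟩ := exists_tendsto_of_abs_deriv_le
    (P := fun s => (∫ τ in (0 : ℝ)..(s + T), (g (x τ - X) - g 0))
      - deriv g 0 * (q (s + T) / (2 * (s + T) ^ 2)))
    (b := fun s => B / (s + T)) (b' := fun s => -(B / (s + T) ^ 2))
    (fun s hs => (hPd (s + T) (by linarith)).comp_add_const s T)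
    (fun s hs => by
      have hs0 : s + T ≠ 0 := by positivity
      refine ((hasDerivAt_const s B).div ((hasDerivAt_id s).add_const T) hs0).congr_deriv ?_
      simp
      ring)
    (fun s hs => by
      rw [neg_neg]
      exact hPb (s + T) (by linarith))
    (fun s hs => by positivity)
    (tendsto_const_nhds.div_atTop (tendsto_atTop_add_const_right _ _ tendsto_id))
  refine ⟨Λ, ?_⟩
  have h1 := hΛ.comp (tendsto_atTop_add_const_right atTop (-T) tendsto_id)
  have h2 := h1.add (hk.const_mul (deriv g 0))
  simpa [Function.comp_def] using h2

theorem im_inner_comm {K : Type*} [NormedAddCommGroup K] [InnerProductSpace ℂ K] 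
    (x y : K) : (⟪y, x⟫_ℂ).im = -(⟪x, y⟫_ℂ).im := by
  rw [← inner_conj_symm, Complex.conj_im]

theorem inner_self_re_eq {K : Type*} [NormedAddCommGroup K] [InnerProductSpace ℂ K] 
    (x : K) : (⟪x, x⟫_ℂ).re = ‖x‖ ^ 2 := by
  rw [inner_self_eq_norm_sq_to_K]; norm_cast

theorem hasDerivAt_re {f : ℝ → ℂ} {f' : ℂ} {s : ℝ} (h : HasDerivAt f f' s) :
    HasDerivAt (fun s => (f s).re) f'.re s :=
  Complex.reCLM.hasFDerivAt.comp_hasDerivAt s h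

theorem hasDerivAt_im {f : ℝ → ℂ} {f' : ℂ} {s : ℝ} (h : HasDerivAt f f' s) :
    HasDerivAt (fun s => (f s).im) f'.im s :=
  Complex.imCLM.hasFDerivAt.comp_hasDerivAt s h

section LinearSystem

variable {K : Type*} [NormedAddCommGroup K] [InnerProductSpace ℂ K]
  {G : K →L[ℂ] K} {a b : ℝ → K}

theorem hasDerivAt_normSq_fst
    (ha : ∀ s : ℝ, HasDerivAt a (Complex.I • ((s : ℂ) • a s + G (b s))) s) (s : ℝ) :
    HasDerivAt (fun s => ‖a s‖ ^ 2) (-2 * (⟪a s, G (b s)⟫_ℂ).im) s := by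
  have h := hasDerivAt_re ((ha s).inner ℂ (ha s))
  simp only [inner_self_re_eq] at h
  refine h.congr_deriv ?_
  have e := im_inner_comm (a s) (G (b s))
  simp only [inner_smul_left, inner_smul_right, inner_add_left, inner_add_right, Complex.add_re,
    Complex.mul_re, Complex.add_im, Complex.mul_im, Complex.conj_I, Complex.neg_re,
    Complex.neg_im, Complex.I_re, Complex.I_im, Complex.conj_ofReal, Complex.ofReal_re,
    Complex.ofReal_im, e]
  ring

variable [CompleteSpace K]

theorem hasDerivAt_normSq_snd
    (hb : ∀ s : ℝ, HasDerivAt b (Complex.I • (adjoint G (a s) - (s : ℂ) • b s)) s) (s : ℝ) :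
    HasDerivAt (fun s => ‖b s‖ ^ 2) (2 * (⟪a s, G (b s)⟫_ℂ).im) s := by
  have h := hasDerivAt_re ((hb s).inner ℂ (hb s))
  simp only [inner_self_re_eq] at h
  refine h.congr_deriv ?_
  have e := im_inner_comm (a s) (G (b s))
  simp only [inner_smul_left, inner_smul_right, inner_sub_left, inner_sub_right, Complex.sub_re,
    Complex.mul_re, Complex.sub_im, Complex.mul_im, Complex.conj_I, Complex.neg_re,
    Complex.neg_im, Complex.I_re, Complex.I_im, Complex.conj_ofReal, Complex.ofReal_re,
    Complex.ofReal_im, adjoint_inner_left, adjoint_inner_right, Complex.add_re, e]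
  ring

theorem norm_sq_add_norm_sq_eq
    (ha : ∀ s : ℝ, HasDerivAt a (Complex.I • ((s : ℂ) • a s + G (b s))) s)
    (hb : ∀ s : ℝ, HasDerivAt b (Complex.I • (adjoint G (a s) - (s : ℂ) • b s)) s) (s : ℝ) :
    ‖a s‖ ^ 2 + ‖b s‖ ^ 2 = ‖a 0‖ ^ 2 + ‖b 0‖ ^ 2 := by
  have h : ∀ s, HasDerivAt (fun s => ‖a s‖ ^ 2 + ‖b s‖ ^ 2) 0 s := fun s =>
    ((hasDerivAt_normSq_fst ha s).add (hasDerivAt_normSq_snd hb s)).congr_deriv (by ring)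
  exact is_const_of_deriv_eq_zero (fun s => (h s).differentiableAt) (fun s => (h s).deriv) s 0

theorem hasDerivAt_inner_coupling
    (ha : ∀ s : ℝ, HasDerivAt a (Complex.I • ((s : ℂ) • a s + G (b s))) s)
    (hb : ∀ s : ℝ, HasDerivAt b (Complex.I • (adjoint G (a s) - (s : ℂ) • b s)) s) (s : ℝ) :
    HasDerivAt (fun s => ⟪a s, G (b s)⟫_ℂ)
      (-2 * s * Complex.I * ⟪a s, G (b s)⟫_ℂ
        + Complex.I * ((‖adjoint G (a s)‖ ^ 2 - ‖G (b s)‖ ^ 2 : ℝ) : ℂ)) s := by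
  have hGb : HasDerivAt (fun s => G (b s))
      (G (Complex.I • (adjoint G (a s) - (s : ℂ) • b s))) s :=
    (G.restrictScalars ℝ).hasFDerivAt.comp_hasDerivAt s (hb s)
  refine ((ha s).inner ℂ hGb).congr_deriv ?_
  have e1 : ⟪a s, G (adjoint G (a s))⟫_ℂ = (‖adjoint G (a s)‖ : ℂ) ^ 2 := by
    rw [← adjoint_inner_left, inner_self_eq_norm_sq_to_K]; rfl
  have e2 : ⟪G (b s), G (b s)⟫_ℂ = (‖G (b s)‖ : ℂ) ^ 2 := by
    rw [inner_self_eq_norm_sq_to_K]; rfl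
  simp only [map_smul, map_sub, inner_smul_left, inner_smul_right, inner_add_left,
    inner_sub_right, Complex.conj_I, Complex.conj_ofReal, e1, e2]
  push_cast
  ring

/-- Along a solution of the linear system whose component norms converge, the deviation of a `C²`
function of the squared norms from its limit has a convergent improper integral. -/
theorem exists_tendsto_integral_of_linear_system
    (ha : ∀ s : ℝ, HasDerivAt a (Complex.I • ((s : ℂ) • a s + G (b s))) s)
    (hb : ∀ s : ℝ, HasDerivAt b (Complex.I • (adjoint G (a s) - (s : ℂ) • b s)) s)
    {X Y : ℝ} (hX : Tendsto (fun s => ‖a s‖ ^ 2) atTop (𝓝 X))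
    (hY : Tendsto (fun s => ‖b s‖ ^ 2) atTop (𝓝 Y)) {f : ℝ × ℝ → ℝ} (hf : ContDiff ℝ 2 f) :
    ∃ Λ, Tendsto (fun t : ℝ => ∫ τ in (0 : ℝ)..t, (f (‖a τ‖ ^ 2, ‖b τ‖ ^ 2) - f (X, Y)))
      atTop (𝓝 Λ) := by
  have hcons := norm_sq_add_norm_sq_eq ha hb
  set N := ‖a 0‖ ^ 2 + ‖b 0‖ ^ 2
  have hXY : X + Y = N := tendsto_nhds_unique
    ((hX.add hY).congr hcons) tendsto_const_nhds
  set M := Real.sqrt N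
  have haM : ∀ s, ‖a s‖ ≤ M := fun s =>
    Real.le_sqrt_of_sq_le (by rw [← hcons s]; linarith [sq_nonneg ‖b s‖])
  have hbM : ∀ s, ‖b s‖ ≤ M := fun s =>
    Real.le_sqrt_of_sq_le (by rw [← hcons s]; linarith [sq_nonneg ‖a s‖])
  have hGb : ∀ s, ‖G (b s)‖ ≤ ‖G‖ * M := fun s => G.le_opNorm_of_le (hbM s)
  have hGa : ∀ s, ‖adjoint G (a s)‖ ≤ ‖G‖ * M := fun s => by
    have := (adjoint G).le_opNorm_of_le (haM s)
    rwa [LinearIsometryEquiv.norm_map] at this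
  have hM : 0 ≤ M := Real.sqrt_nonneg _
  set C := M * (‖G‖ * M) + (‖G‖ * M) ^ 2
  have hc : ∀ s, ‖⟪a s, G (b s)⟫_ℂ‖ ≤ C := fun s => by
    have h1 := norm_inner_le_norm (𝕜 := ℂ) (a s) (G (b s))
    have h2 : ‖a s‖ * ‖G (b s)‖ ≤ M * (‖G‖ * M) := by
      gcongr
      exacts [haM s, hGb s]
    exact h1.trans (h2.trans (le_add_of_nonneg_right (sq_nonneg _)))
  have hder := hasDerivAt_inner_coupling ha hb
  obtain ⟨Λ, hΛ⟩ := exists_tendsto_integral_of_bloch_system (C := C) (X := X)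
    (x := fun s => ‖a s‖ ^ 2) (p := fun s => (⟪a s, G (b s)⟫_ℂ).re)
    (q := fun s => (⟪a s, G (b s)⟫_ℂ).im)
    (D := fun s => ‖adjoint G (a s)‖ ^ 2 - ‖G (b s)‖ ^ 2)
    (g := fun e => f (X + e, Y - e))
    (hasDerivAt_normSq_fst ha)
    (fun s => (hasDerivAt_re (hder s)).congr_deriv (by
      simp only [Complex.add_re, Complex.mul_re, Complex.mul_im, Complex.I_re, Complex.I_im,
        Complex.ofReal_re, Complex.ofReal_im, Complex.neg_re, Complex.neg_im, Complex.re_ofNat,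
        Complex.im_ofNat]
      ring))
    (fun s => (hasDerivAt_im (hder s)).congr_deriv (by
      simp only [Complex.add_im, Complex.mul_re, Complex.mul_im, Complex.I_re, Complex.I_im,
        Complex.ofReal_re, Complex.ofReal_im, Complex.neg_re, Complex.neg_im, Complex.re_ofNat,
        Complex.im_ofNat]
      ring))
    (fun s => (Complex.abs_re_le_norm _).trans (hc s))
    (fun s => (Complex.abs_im_le_norm _).trans (hc s))
    (fun s => by
      have h1 : ‖adjoint G (a s)‖ ^ 2 ≤ (‖G‖ * M) ^ 2 := by
        gcongr
        exact hGa s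
      have h2 : ‖G (b s)‖ ^ 2 ≤ (‖G‖ * M) ^ 2 := by
        gcongr
        exact hGb s
      have h3 : 0 ≤ M * (‖G‖ * M) := by positivity
      rw [abs_le]
      constructor <;> nlinarith [sq_nonneg ‖adjoint G (a s)‖, sq_nonneg ‖G (b s)‖])
    hX (hf.comp ((contDiff_const.add contDiff_id).prodMk (contDiff_const.sub contDiff_id)))
  refine ⟨Λ, hΛ.congr fun t => ?_⟩
  refine intervalIntegral.integral_congr fun τ _ => ?_
  have h1 : X + (‖a τ‖ ^ 2 - X) = ‖a τ‖ ^ 2 := by ring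
  have h2 : Y - (‖a τ‖ ^ 2 - X) = ‖b τ‖ ^ 2 := by linarith [hcons τ]
  simp only [h1, h2, add_zero, sub_zero]

end LinearSystem

section Isometry

variable {K : Type*} [NormedAddCommGroup K] [InnerProductSpace ℂ K] [CompleteSpace K]

/-- The functional calculus of a unimodular continuous function is isometric. -/
theorem norm_fc_apply {χ : ℝ → ℂ} (hχ : Continuous χ) (h1 : ∀ x, ‖χ x‖ = 1) {A : K →L[ℂ] K}
    (hA : IsSelfAdjoint A) (w : K) : ‖fc χ A w‖ = ‖w‖ := by
  have hre : Continuous fun x => (χ x).re := Complex.continuous_re.comp hχ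
  have him : Continuous fun x => (χ x).im := Complex.continuous_im.comp hχ
  set B := cfc (fun x : ℝ => (χ x).re) A with hB
  set D := cfc (fun x : ℝ => (χ x).im) A with hD
  have hBs : star B = B := (cfc_predicate (fun x : ℝ => (χ x).re) A : IsSelfAdjoint _)
  have hDs : star D = D := (cfc_predicate (fun x : ℝ => (χ x).im) A : IsSelfAdjoint _)
  have hBD : B * D = D * B := cfc_commute_cfc _ _ A
  have hsum : B * B + D * D = 1 := by
    rw [hB, hD, ← cfc_mul _ _ A hre.continuousOn hre.continuousOn,
      ← cfc_mul _ _ A him.continuousOn him.continuousOn,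
      ← cfc_add (a := A) (fun x => (χ x).re * (χ x).re) (fun x => (χ x).im * (χ x).im)
        (hre.mul hre).continuousOn (him.mul him).continuousOn, ← cfc_const_one ℝ A]
    congr 1
    ext x
    have := h1 x
    rw [← sq_eq_sq₀ (norm_nonneg _) zero_le_one, Complex.sq_norm, Complex.normSq_apply] at this
    simpa using this
  have hu : star (fc χ A) * fc χ A = 1 := by
    change star (B + Complex.I • D) * (B + Complex.I • D) = 1
    rw [star_add, star_smul, hBs, hDs, ← hsum]
    simp only [add_mul, mul_add, smul_mul_assoc, mul_smul_comm, hBD, Complex.star_def,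
      Complex.conj_I]
    match_scalars <;> simp
  exact (ContinuousLinearMap.norm_map_iff_adjoint_comp_self (fc χ A)).2 hu w

theorem continuous_phase (s : ℝ) : Continuous (phase s) := by
  unfold phase
  fun_prop

theorem norm_ePhaseP (G : K →L[ℂ] K) (s : ℝ) (w : K) : ‖ePhaseP G s w‖ = ‖w‖ := by
  have := continuous_phase s
  exact norm_fc_apply (by fun_prop) (fun x => by rw [mul_comm, Complex.norm_exp_ofReal_mul_I])
    (IsSelfAdjoint.mul_star_self G) w

theorem norm_ePhaseM (G : K →L[ℂ] K) (s : ℝ) (w : K) : ‖ePhaseM G s w‖ = ‖w‖ := by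
  have := continuous_phase s
  refine norm_fc_apply (by fun_prop) (fun x => ?_) (IsSelfAdjoint.star_mul_self G) w
  rw [Complex.exp_neg, norm_inv, mul_comm, Complex.norm_exp_ofReal_mul_I, inv_one]

end Isometry

section Scattering

variable {K : Type*} [NormedAddCommGroup K] [InnerProductSpace ℂ K]

/-- Identification of the limit state from the comparison of two asymptotics that differ by a
scalar phase. -/
theorem eq_exp_smul_of_tendsto {P : ℝ → K →L[ℂ] K} (hP : ∀ s w, ‖P s w‖ = ‖w‖)
    {η : ℝ → ℝ} {c Λ : ℝ} (hη : Tendsto (fun s => η s - c * s) atTop (𝓝 Λ))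
    {v : ℝ → K} {w w' : K}
    (h1 : Tendsto (fun s => ‖Complex.exp (Complex.I * η s) • v s
      - Complex.exp (Complex.I * (c * s)) • P s w‖) atTop (𝓝 0))
    (h2 : Tendsto (fun s => ‖v s - P s w'‖) atTop (𝓝 0)) :
    w = Complex.exp (Complex.I * Λ) • w' := by
  have hunit : ∀ x : ℝ, ‖Complex.exp (Complex.I * x)‖ = 1 := fun x => by
    rw [mul_comm, Complex.norm_exp_ofReal_mul_I]
  have hz : Tendsto (fun s => Complex.exp (Complex.I * ((η s - c * s : ℝ) : ℂ)) • w' - w) atTop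
      (𝓝 0) := by
    refine squeeze_zero_norm (fun s => ?_) (by simpa using h2.add h1)
    have e : Complex.exp (Complex.I * η s)
        = Complex.exp (Complex.I * ((c * s : ℝ) : ℂ))
          * Complex.exp (Complex.I * ((η s - c * s : ℝ) : ℂ)) := by
      rw [← Complex.exp_add]
      push_cast
      ring_nf
    calc _ = ‖Complex.exp (Complex.I * ((c * s : ℝ) : ℂ)) •
          P s (Complex.exp (Complex.I * ((η s - c * s : ℝ) : ℂ)) • w' - w)‖ := by
          rw [norm_smul, hunit, one_mul, hP]
      _ = ‖-(Complex.exp (Complex.I * η s) • (v s - P s w'))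
          + (Complex.exp (Complex.I * η s) • v s
            - Complex.exp (Complex.I * (c * s)) • P s w)‖ := by
          rw [map_sub, map_smul, smul_sub, smul_smul, ← e]
          push_cast
          congr 1
          module
      _ ≤ _ := (norm_add_le _ _).trans_eq (by rw [norm_neg, norm_smul, hunit, one_mul])
  have hl : Tendsto (fun s => Complex.exp (Complex.I * ((η s - c * s : ℝ) : ℂ)) • w' - w) atTop
      (𝓝 (Complex.exp (Complex.I * Λ) • w' - w)) := by
    have := (Complex.continuous_ofReal.tendsto Λ).comp hη
    exact (((Complex.continuous_exp.tendsto _).comp (this.const_mul Complex.I)).smul_const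
      w').sub_const w
  exact (sub_eq_zero.1 (tendsto_nhds_unique hl hz)).symm

variable [CompleteSpace K] {G : K →L[ℂ] K} {δ : ℝ} {f : ℝ × ℝ → ℝ} {u ulin : ℝ → WithLp 2 (K × K)}

theorem IsLZSol.hasDerivAt_fst (hu : IsLZSol G δ f f u) (s : ℝ) :
    HasDerivAt (fun s => (u s).fst)
      (Complex.I • ((s : ℂ) • (u s).fst + G (u s).snd + ((δ * F1 f (u s) : ℝ) : ℂ) • (u s).fst))
      s := by
  refine (((WithLp.fstL 2 ℂ K K).restrictScalars ℝ).hasFDerivAt.comp_hasDerivAt s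
    (hu s)).congr_deriv ?_
  change Complex.I • ((s : ℂ) • (u s).fst + G (u s).snd + δ • F1 f (u s) • (u s).fst) = _
  rw [smul_smul, Complex.coe_smul]
  rfl

theorem IsLZSol.hasDerivAt_snd (hu : IsLZSol G δ f f u) (s : ℝ) :
    HasDerivAt (fun s => (u s).snd)
      (Complex.I • (adjoint G (u s).fst - (s : ℂ) • (u s).snd
        + ((δ * F1 f (u s) : ℝ) : ℂ) • (u s).snd)) s := by
  refine (((WithLp.sndL 2 ℂ K K).restrictScalars ℝ).hasFDerivAt.comp_hasDerivAt s
    (hu s)).congr_deriv ?_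
  change Complex.I • (adjoint G (u s).fst - (s : ℂ) • (u s).snd + δ • F2 f (u s) • (u s).snd) = _
  rw [smul_smul, Complex.coe_smul]
  rfl

theorem IsLZSol.continuous_F1 (hu : IsLZSol G δ f f u) (hf : Continuous f) :
    Continuous fun s => F1 f (u s) := by
  have h1 : Continuous fun s => (u s).fst :=
    continuous_iff_continuousAt.2 fun s => (hu.hasDerivAt_fst s).continuousAt
  have h2 : Continuous fun s => (u s).snd :=
    continuous_iff_continuousAt.2 fun s => (hu.hasDerivAt_snd s).continuousAt
  exact hf.comp ((h1.norm.pow 2).prodMk (h2.norm.pow 2))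

theorem IsLZSol.linear_fst (h : IsLZSol G 0 f f ulin) (s : ℝ) :
    HasDerivAt (fun s => (ulin s).fst)
      (Complex.I • ((s : ℂ) • (ulin s).fst + G (ulin s).snd)) s := by
  simpa using h.hasDerivAt_fst s

theorem IsLZSol.linear_snd (h : IsLZSol G 0 f f ulin) (s : ℝ) :
    HasDerivAt (fun s => (ulin s).snd)
      (Complex.I • (adjoint G (ulin s).fst - (s : ℂ) • (ulin s).snd)) s := by
  simpa using h.hasDerivAt_snd s

/-- When `f₁ = f₂`, the nonlinear solution is the linear one up to an explicit scalar phase. -/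
theorem IsLZSol.eq_exp_smul_linear (hu : IsLZSol G δ f f u) (hulin : IsLZSol G 0 f f ulin)
    (h0 : u 0 = ulin 0) (hf : Continuous f) (s : ℝ) :
    u s = Complex.exp (Complex.I * ((δ * ∫ τ in (0 : ℝ)..s, F1 f (ulin τ) : ℝ) : ℂ)) • ulin s := by
  set E : ℝ → ℂ := fun s =>
    Complex.exp (Complex.I * ((-(δ * ∫ τ in (0 : ℝ)..s, F1 f (u τ)) : ℝ) : ℂ)) with hE
  have hunit : ∀ s, ‖E s‖ = 1 := fun s => by
    rw [hE]
    simp only [mul_comm Complex.I, Complex.norm_exp_ofReal_mul_I]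
  have hE' : ∀ s, HasDerivAt E (E s * (Complex.I * ((-(δ * F1 f (u s)) : ℝ) : ℂ))) s := fun s =>
    ((((hu.continuous_F1 hf).integral_hasStrictDerivAt 0 s).hasDerivAt.const_mul δ).neg
      |>.ofReal_comp.const_mul Complex.I).cexp
  have hfst := fun s => ((hE' s).smul (hu.hasDerivAt_fst s)).sub (hulin.linear_fst s)
  have hsnd := fun s => ((hE' s).smul (hu.hasDerivAt_snd s)).sub (hulin.linear_snd s)
  have hcons := norm_sq_add_norm_sq_eq (G := G)
    (a := fun s => E s • (u s).fst - (ulin s).fst) (b := fun s => E s • (u s).snd - (ulin s).snd)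
    (fun s => (hfst s).congr_deriv (by
      simp only [map_sub, map_smul]
      push_cast
      module))
    (fun s => (hsnd s).congr_deriv (by
      simp only [map_sub, map_smul]
      push_cast
      module))
  have hE0 : E 0 = 1 := by simp [hE]
  have hgauge : ∀ s, E s • (u s).fst = (ulin s).fst ∧ E s • (u s).snd = (ulin s).snd := by
    intro s
    have h := hcons s
    simp only [hE0, h0, one_smul, sub_self, norm_zero] at h
    have h1 : ‖E s • (u s).fst - (ulin s).fst‖ ^ 2 = 0 := by
      nlinarith [sq_nonneg ‖E s • (u s).fst - (ulin s).fst‖,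
        sq_nonneg ‖E s • (u s).snd - (ulin s).snd‖]
    have h2 : ‖E s • (u s).snd - (ulin s).snd‖ ^ 2 = 0 := by
      nlinarith [sq_nonneg ‖E s • (u s).fst - (ulin s).fst‖,
        sq_nonneg ‖E s • (u s).snd - (ulin s).snd‖]
    exact ⟨sub_eq_zero.1 (norm_eq_zero.1 (pow_eq_zero_iff two_ne_zero |>.1 h1)),
      sub_eq_zero.1 (norm_eq_zero.1 (pow_eq_zero_iff two_ne_zero |>.1 h2))⟩
  have hF : ∀ s, F1 f (u s) = F1 f (ulin s) := fun s => by
    simp only [F1, ← (hgauge s).1, ← (hgauge s).2, norm_smul, hunit, one_mul]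
  have hlin : ulin s = E s • u s := by
    apply (WithLp.equiv 2 (K × K)).injective
    exact Prod.ext (hgauge s).1.symm (hgauge s).2.symm
  rw [hlin, smul_smul, hE, ← Complex.exp_add]
  simp only [← hF]
  rw [← mul_add, ← Complex.ofReal_add, add_neg_cancel]
  simp

theorem norm_asym1 (ω : WithLp 2 (K × K)) (s : ℝ) : ‖asym1 G δ f ω 0 s‖ = ‖ω.fst‖ := by
  have h := Complex.norm_exp_ofReal_mul_I (δ * F1 f ω * s)
  rw [asym1, norm_smul, norm_ePhaseP]
  push_cast at h ⊢
  rw [add_zero, mul_comm Complex.I, h, one_mul]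

theorem norm_asym2 (ω : WithLp 2 (K × K)) (s : ℝ) : ‖asym2 G δ f ω 0 s‖ = ‖ω.snd‖ := by
  have h := Complex.norm_exp_ofReal_mul_I (δ * F2 f ω * s)
  rw [asym2, norm_smul, norm_ePhaseM]
  push_cast at h ⊢
  rw [sub_zero, mul_comm Complex.I, h, one_mul]

theorem Outgoing.fst {ω : WithLp 2 (K × K)} (h : Outgoing G δ f f ω 0 u) :
    Tendsto (fun s => ‖(u s).fst - asym1 G δ f ω 0 s‖) atTop (𝓝 0) :=
  squeeze_zero (fun _ => norm_nonneg _) (fun _ => le_add_of_nonneg_right (norm_nonneg _)) h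

theorem Outgoing.snd {ω : WithLp 2 (K × K)} (h : Outgoing G δ f f ω 0 u) :
    Tendsto (fun s => ‖(u s).snd - asym2 G δ f ω 0 s‖) atTop (𝓝 0) :=
  squeeze_zero (fun _ => norm_nonneg _) (fun _ => le_add_of_nonneg_left (norm_nonneg _)) h

theorem Outgoing.tendsto_norm_fst {ω : WithLp 2 (K × K)} (h : Outgoing G δ f f ω 0 u) :
    Tendsto (fun s => ‖(u s).fst‖) atTop (𝓝 ‖ω.fst‖) := by
  refine tendsto_iff_dist_tendsto_zero.2 (squeeze_zero (fun _ => dist_nonneg) (fun s => ?_) h.fst)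
  rw [Real.dist_eq, ← norm_asym1 (G := G) (δ := δ) (f := f) ω s]
  exact abs_norm_sub_norm_le _ _

theorem Outgoing.tendsto_norm_snd {ω : WithLp 2 (K × K)} (h : Outgoing G δ f f ω 0 u) :
    Tendsto (fun s => ‖(u s).snd‖) atTop (𝓝 ‖ω.snd‖) := by
  refine tendsto_iff_dist_tendsto_zero.2 (squeeze_zero (fun _ => dist_nonneg) (fun s => ?_) h.snd)
  rw [Real.dist_eq, ← norm_asym2 (G := G) (δ := δ) (f := f) ω s]
  exact abs_norm_sub_norm_le _ _

/-- Exact formula for the outgoing scattering state when `f₁ = f₂`. -/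
theorem IsLZSol.outgoing_eq (hu : IsLZSol G δ f f u) (hulin : IsLZSol G 0 f f ulin)
    (h0 : u 0 = ulin 0) (hf : ContDiff ℝ 2 f) {ω ωlin : WithLp 2 (K × K)}
    (hω : Outgoing G δ f f ω 0 u) (hωlin : Outgoing G 0 f f ωlin 0 ulin) :
    ∃ Λ : ℝ, Tendsto (fun t : ℝ => ∫ τ in (0 : ℝ)..t, (F1 f (ulin τ) - F1 f ωlin)) atTop (𝓝 Λ) ∧
      ω = Complex.exp (Complex.I * (δ * Λ)) • ωlin := by
  obtain ⟨Λ, hΛ⟩ := exists_tendsto_integral_of_linear_system hulin.linear_fst hulin.linear_snd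
    (hωlin.tendsto_norm_fst.pow 2) (hωlin.tendsto_norm_snd.pow 2) hf
  refine ⟨Λ, hΛ, ?_⟩
  have hgauge := hu.eq_exp_smul_linear hulin h0 hf.continuous
  have hunit : ∀ x : ℝ, ‖Complex.exp (Complex.I * x)‖ = 1 := fun x => by
    rw [mul_comm, Complex.norm_exp_ofReal_mul_I]
  have hn1 : ‖ω.fst‖ = ‖ωlin.fst‖ := by
    refine tendsto_nhds_unique hω.tendsto_norm_fst (hωlin.tendsto_norm_fst.congr fun s => ?_)
    rw [hgauge s, WithLp.smul_fst, norm_smul, hunit, one_mul]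
  have hn2 : ‖ω.snd‖ = ‖ωlin.snd‖ := by
    refine tendsto_nhds_unique hω.tendsto_norm_snd (hωlin.tendsto_norm_snd.congr fun s => ?_)
    rw [hgauge s, WithLp.smul_snd, norm_smul, hunit, one_mul]
  have hF : F1 f ω = F1 f ωlin := by simp only [F1, hn1, hn2]
  have hF2 : F2 f ω = F1 f ωlin := hF
  have hη : Tendsto (fun s => (δ * ∫ τ in (0 : ℝ)..s, F1 f (ulin τ)) - δ * F1 f ωlin * s) atTop
      (𝓝 (δ * Λ)) := by
    refine (hΛ.const_mul δ).congr fun t => ?_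
    change δ * ∫ τ in (0 : ℝ)..t, (F1 f (ulin τ) - F1 f ωlin) = _
    rw [intervalIntegral.integral_sub ((hulin.continuous_F1 hf.continuous).intervalIntegrable _ _)
      (continuous_const.intervalIntegrable _ _), intervalIntegral.integral_const]
    simp only [smul_eq_mul, sub_zero]
    ring
  have hfst : ω.fst = Complex.exp (Complex.I * ((δ * Λ : ℝ) : ℂ)) • ωlin.fst := by
    refine eq_exp_smul_of_tendsto (P := ePhaseP G) (v := fun s => (ulin s).fst)
      (norm_ePhaseP G) hη (hω.fst.congr fun s => ?_) (hωlin.fst.congr fun s => ?_)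
    · rw [hgauge s, asym1, hF]
      simp
    · simp [asym1]
  have hsnd : ω.snd = Complex.exp (Complex.I * ((δ * Λ : ℝ) : ℂ)) • ωlin.snd := by
    refine eq_exp_smul_of_tendsto (P := ePhaseM G) (v := fun s => (ulin s).snd)
      (norm_ePhaseM G) hη (hω.snd.congr fun s => ?_) (hωlin.snd.congr fun s => ?_)
    · rw [hgauge s, asym2, hF2]
      simp
    · simp [asym2]
  rw [← Complex.ofReal_mul]
  apply (WithLp.equiv 2 (K × K)).injective
  exact Prod.ext hfst hsnd

/-- Time reversal maps solutions to solutions with `G` and `δ` replaced by their opposites. -/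
theorem IsLZSol.comp_neg (hu : IsLZSol G δ f f u) :
    IsLZSol (-G) (-δ) f f (fun s => u (-s)) := by
  intro s
  refine ((hu (-s)).scomp s (hasDerivAt_neg s)).congr_deriv ?_
  apply (WithLp.equiv 2 (K × K)).injective
  refine Prod.ext ?_ ?_
  · change (-1 : ℝ) • Complex.I • ((((-s : ℝ) : ℂ) • (u (-s)).fst + G (u (-s)).snd)
        + δ • F1 f (u (-s)) • (u (-s)).fst)
      = Complex.I • (((s : ℂ) • (u (-s)).fst + (-G) (u (-s)).snd)
        + (-δ) • F1 f (u (-s)) • (u (-s)).fst)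
    simp only [neg_apply]
    push_cast
    module
  · change (-1 : ℝ) • Complex.I • ((adjoint G (u (-s)).fst - ((-s : ℝ) : ℂ) • (u (-s)).snd)
        + δ • F2 f (u (-s)) • (u (-s)).snd)
      = Complex.I • ((adjoint (-G) (u (-s)).fst - (s : ℂ) • (u (-s)).snd)
        + (-δ) • F2 f (u (-s)) • (u (-s)).snd)
    simp only [map_neg, neg_apply]
    push_cast
    module

theorem Incoming.comp_neg {α : WithLp 2 (K × K)} (h : Incoming G δ f f α 0 u) :
    Outgoing (-G) (-δ) f f α 0 (fun s => u (-s)) := by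
  refine (Tendsto.comp h tendsto_neg_atTop_atBot).congr fun s => ?_
  simp [asym1, asym2, ePhaseP, ePhaseM, phase]

end Scattering

/-- exact formula for the scattering states when `f₁ = f₂`
(second part of Theorem 1.12). -/
theorem stmt_5 {K : Type*} [NormedAddCommGroup K] [InnerProductSpace ℂ K]
    [FiniteDimensional ℂ K]
    (G : K →L[ℂ] K) (hG : CommHyp G) (δ : ℝ) (f₁ f₂ : ℝ × ℝ → ℝ)
    (hf₁ : C2Bdd f₁) (hf₂ : C2Bdd f₂) (hf : f₁ = f₂) (θ : ℝ → ℝ) (hθ : IsCutoff θ)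
    (R : ℝ) (hR : 0 < R) (u₀ : WithLp 2 (K × K)) (hu₀ : Theta G θ R u₀ = u₀)
    (hn : ‖u₀.fst‖ ^ 2 + ‖u₀.snd‖ ^ 2 = 1)
    (u : ℝ → WithLp 2 (K × K)) (hu : IsLZSol G δ f₁ f₂ u) (hu0 : u 0 = u₀)
    (ulin : ℝ → WithLp 2 (K × K)) (hulin : IsLZSol G 0 f₁ f₂ ulin) (hulin0 : ulin 0 = u₀)
    (α ω αlin ωlin : WithLp 2 (K × K))
    (hω : Outgoing G δ f₁ f₂ ω 0 u) (hα : Incoming G δ f₁ f₂ α 0 u)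
    (hωlin : Outgoing G 0 f₁ f₂ ωlin 0 ulin) (hαlin : Incoming G 0 f₁ f₂ αlin 0 ulin) :
    ∃ Λm Λp : ℝ,
      Tendsto (fun t : ℝ => ∫ τ in t..(0 : ℝ), (F1 f₁ (ulin τ) - F1 f₁ αlin))
        atBot (𝓝 Λm) ∧
      Tendsto (fun t : ℝ => ∫ τ in (0 : ℝ)..t, (F1 f₁ (ulin τ) - F1 f₁ ωlin))
        atTop (𝓝 Λp) ∧
      ω = Complex.exp (Complex.I * (δ * Λp)) • ωlin ∧
      α = Complex.exp (-(Complex.I * (δ * Λm))) • αlin := by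
  subst hf
  have : CompleteSpace K := FiniteDimensional.complete ℂ K
  obtain ⟨Λp, hΛp, hp⟩ := hu.outgoing_eq hulin (hu0.trans hulin0.symm) hf₁.1 hω hωlin
  have hulin' : IsLZSol (-G) 0 f₁ f₁ (fun s => ulin (-s)) := by simpa using hulin.comp_neg
  have hαlin' : Outgoing (-G) 0 f₁ f₁ αlin 0 (fun s => ulin (-s)) := by simpa using hαlin.comp_neg
  obtain ⟨Λm, hΛm, hm⟩ := hu.comp_neg.outgoing_eq hulin' (by simp [hu0, hulin0]) hf₁.1
    hα.comp_neg hαlin'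
  refine ⟨Λm, Λp, ?_, hΛp, hp, ?_⟩
  · refine (hΛm.comp tendsto_neg_atBot_atTop).congr fun t => ?_
    have := intervalIntegral.integral_comp_neg (a := 0) (b := -t)
      (fun τ => F1 f₁ (ulin τ) - F1 f₁ αlin)
    simpa using this
  · rw [hm]
    congr 2
    push_cast
    ring

end
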